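/- arXiv:1405.0630 — 2 statements merged into one kernel-verified Lean document; each statement's English description precedes it below -/
import Mathlib

section
/- Let k be a field, let γ, c ∈ k[t] with deg γ = deg c and γ − c non-constant, and let φ(x) = (x−γ)² + c. Set ρ = log₂(deg γ / deg(γ−c)) + 1 (a real number). Then for every integer m ≥ 1 with m ≤ ρ, the polynomial φ^m(γ) ∈ k[t] has degree at most deg γ; and for every integer m > ρ, φ^m(γ) has degree exactly 2^(m−1) · deg(γ−c). -/
open Polynomial

/-- If `γ - c` is non-constant, the distance from `γ` of its iterates under `a ↦ (a - γ)² + c`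
has degree doubling at each step. -/
lemma natDegree_iterate_sub (k : Type*) [Field k] (γ c : Polynomial k)
    (hnc : (γ - c).natDegree ≠ 0) (n : ℕ) :
    ((fun a => (a - γ) ^ 2 + c)^[n + 1] γ - γ).natDegree = 2 ^ n * (γ - c).natDegree := by
  induction n with
  | zero => simpa using natDegree_sub
  | succ n ih =>
    rw [Function.iterate_succ_apply', add_sub_assoc, natDegree_add_eq_left_of_natDegree_lt]
    · rw [natDegree_pow, ih]
      ring
    · rw [natDegree_pow, ih, natDegree_sub (p := c)]
      have : 1 ≤ 2 ^ n := Nat.one_le_two_pow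
      nlinarith [Nat.pos_of_ne_zero hnc]

/-- Comparison of an integer with `log₂ (g / d) + 1`, cleared of logarithms. -/
lemma natCast_succ_le_logb_div_add_one_iff {g d : ℕ} (hg : 0 < g) (hd : 0 < d) (n : ℕ) :
    ((n + 1 : ℕ) : ℝ) ≤ Real.logb 2 ((g : ℝ) / d) + 1 ↔ 2 ^ n * d ≤ g := by
  have hg' : (0 : ℝ) < g := by exact_mod_cast hg
  have hd' : (0 : ℝ) < d := by exact_mod_cast hd
  rw [Nat.cast_succ, add_le_add_iff_right, Real.le_logb_iff_rpow_le one_lt_two (by positivity),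
    Real.rpow_natCast, le_div_iff₀ hd']
  exact_mod_cast Iff.rfl

/-- Lemma 2 parts 2(a),(b): if `h(γ) = h(c)` and `h(γ-c) > 0`, set
`ρ = log₂(h(γ)/h(γ-c)) + 1`. Then `h(φ^m(γ)) ≤ h(γ)` for `1 ≤ m ≤ ρ`, and
`h(φ^m(γ)) = 2^(m-1)·h(γ-c)` for `m > ρ`. -/
theorem height_critical_orbit_eq (k : Type*) [Field k] (γ c : Polynomial k)
    (hdeg : γ.natDegree = c.natDegree)
    (hnc : (γ - c).natDegree ≠ 0) :
    (∀ m : ℕ, 1 ≤ m →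
      (m : ℝ) ≤ Real.logb 2 ((γ.natDegree : ℝ) / ((γ - c).natDegree : ℝ)) + 1 →
      ((fun a => (a - γ) ^ 2 + c)^[m] γ).natDegree ≤ γ.natDegree) ∧
    (∀ m : ℕ,
      (m : ℝ) > Real.logb 2 ((γ.natDegree : ℝ) / ((γ - c).natDegree : ℝ)) + 1 →
      ((fun a => (a - γ) ^ 2 + c)^[m] γ).natDegree
        = 2 ^ (m - 1) * (γ - c).natDegree) := by
  have hd : 0 < (γ - c).natDegree := Nat.pos_of_ne_zero hnc
  have hle : (γ - c).natDegree ≤ γ.natDegree :=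
    (natDegree_sub_le γ c).trans (by rw [← hdeg, max_self])
  have hlog := natCast_succ_le_logb_div_add_one_iff (hd.trans_le hle) hd
  have horbit := natDegree_iterate_sub k γ c hnc
  refine ⟨fun m hm hρ => ?_, fun m hρ => ?_⟩
  · obtain ⟨n, rfl⟩ := Nat.exists_eq_add_of_le' hm
    rw [hlog, ← horbit] at hρ
    rw [← sub_add_cancel ((fun a => (a - γ) ^ 2 + c)^[n + 1] γ) γ]
    exact natDegree_add_le_of_degree_le hρ le_rfl
  · cases m with
    | zero =>
      have := (hlog 0).2 (by simpa using hle)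
      push_cast at this hρ
      linarith
    | succ n =>
      rw [gt_iff_lt, ← not_le, hlog, not_le, ← horbit] at hρ
      rw [Nat.add_sub_cancel, ← horbit,
        ← natDegree_add_eq_left_of_natDegree_lt hρ, sub_add_cancel]
end

section
/- Let k be a field of characteristic zero, K = k(t), let f ∈ k[t] be a non-constant polynomial such that −f is not a square in k[t], and let φ_f(x) = x² + f. Then φ_f is stable (every iterate φ_f^n is irreducible over K), and for every n ≥ 17 the extension K_n/K_{n−1} is maximal, i.e. the splitting field of φ_f^n over K_{n−1} has degree 2^(2^(n−1)) over K_{n−1}. -/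
open Polynomial

/-- The `n`-th iterate of `z ↦ z² + c` at `z`. -/
def quadIter {R : Type*} [CommRing R] (c : R) (n : ℕ) (z : R) : R :=
  (fun w => w ^ 2 + c)^[n] z

section QuadIter

variable {R S : Type*} [CommRing R] [CommRing S]

theorem quadIter_zero (c z : R) : quadIter c 0 z = z := rfl

theorem quadIter_succ (c z : R) (n : ℕ) : quadIter c (n + 1) z = quadIter c n (z ^ 2 + c) := rfl

theorem quadIter_succ' (c z : R) (n : ℕ) : quadIter c (n + 1) z = quadIter c n z ^ 2 + c :=
  Function.iterate_succ_apply' _ _ _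

theorem map_quadIter (g : R →+* S) (c z : R) (n : ℕ) :
    g (quadIter c n z) = quadIter (g c) n (g z) := by
  induction n with
  | zero => rfl
  | succ n ih => simp [quadIter_succ', ih]

theorem eval_quadIter (c z : R) (n : ℕ) :
    (quadIter (C c) n (X : R[X])).eval z = quadIter c n z := by
  simpa using map_quadIter (evalRingHom z) (C c) X n

theorem map_quadIter_poly (g : R →+* S) (c : R) (n : ℕ) :
    (quadIter (C c) n (X : R[X])).map g = quadIter (C (g c)) n X := by
  simpa using map_quadIter (mapRingHom g) (C c) X n

theorem quadIter_comp (c : R) (n : ℕ) :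
    quadIter (C c) (n + 1) (X : R[X]) = (quadIter (C c) n X).comp (X ^ 2 + C c) := by
  rw [quadIter_succ]
  simpa using (map_quadIter (compRingHom (X ^ 2 + C c)) (C c) X n).symm

theorem iterate_comp_eq_quadIter (c : R) (n : ℕ) :
    (fun p : R[X] => p.comp (X ^ 2 + C c))^[n] X = quadIter (C c) n X := by
  induction n with
  | zero => rfl
  | succ n ih => rw [Function.iterate_succ_apply', ih, quadIter_comp]

theorem quadIter_monic_natDegree [Nontrivial R] (c : R) (n : ℕ) :
    (quadIter (C c) n (X : R[X])).Monic ∧ (quadIter (C c) n (X : R[X])).natDegree = 2 ^ n := by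
  induction n with
  | zero => simp [quadIter_zero, monic_X]
  | succ n ih =>
    obtain ⟨hm, hd⟩ := ih
    have hlt : (C c).degree < (quadIter (C c) n (X : R[X]) ^ 2).degree := by
      refine lt_of_le_of_lt degree_C_le ?_
      rw [← natDegree_pos_iff_degree_pos, hm.natDegree_pow, hd]
      positivity
    rw [quadIter_succ']
    refine ⟨(hm.pow 2).add_of_left hlt, ?_⟩
    rw [natDegree_add_eq_left_of_degree_lt hlt, hm.natDegree_pow, hd, pow_succ, mul_comm]

theorem quadIter_monic [Nontrivial R] (c : R) (n : ℕ) : (quadIter (C c) n (X : R[X])).Monic :=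
  (quadIter_monic_natDegree c n).1

theorem natDegree_quadIter [Nontrivial R] (c : R) (n : ℕ) :
    (quadIter (C c) n (X : R[X])).natDegree = 2 ^ n :=
  (quadIter_monic_natDegree c n).2

/-- Two returns of the critical orbit to zero force a return in the first half. -/
theorem exists_quadIter_eq_zero_le_half {c : R} {i n : ℕ} (hi : 0 < i) (hin : i < n)
    (h : quadIter c i 0 = 0) (hn : quadIter c n 0 = 0) :
    ∃ j, 0 < j ∧ j ≤ n / 2 ∧ quadIter c j 0 = 0 := by
  set T : R → R := fun w => w ^ 2 + c
  have hpi : Function.IsPeriodicPt T i 0 := h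
  have hpn : Function.IsPeriodicPt T n 0 := hn
  refine ⟨Function.minimalPeriod T 0, hpi.minimalPeriod_pos hi, ?_,
    Function.isPeriodicPt_minimalPeriod T 0⟩
  obtain ⟨q, hq⟩ := hpn.minimalPeriod_dvd
  have hle := hpi.minimalPeriod_le hi
  have hq2 : 2 ≤ q := by
    by_contra! hlt
    interval_cases q <;> omega
  rw [Nat.le_div_iff_mul_le two_pos]
  calc _ ≤ Function.minimalPeriod T 0 * q := Nat.mul_le_mul_left _ hq2
    _ = n := hq.symm

end QuadIter

section DegreeBound

variable {L : Type*} [Field L]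

theorem natDegree_critOrbit {f : L[X]} (hf : f.natDegree ≠ 0) (n : ℕ) :
    (quadIter f (n + 1) 0).natDegree = f.natDegree * 2 ^ n := by
  induction n with
  | zero => simp [quadIter_succ', quadIter_zero]
  | succ n ih =>
    have h : f.natDegree < (quadIter f (n + 1) 0 ^ 2).natDegree := by
      rw [natDegree_pow, ih]
      have : 0 < 2 ^ n := by positivity
      nlinarith [Nat.pos_of_ne_zero hf]
    rw [quadIter_succ', natDegree_add_eq_left_of_natDegree_lt h, natDegree_pow, ih]
    ring

/-- A polynomial in the critical orbit, past the first, is not a square. -/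
theorem not_isSquare_critOrbit [CharZero L] {f : L[X]} (hf : f.natDegree ≠ 0) (n : ℕ) :
    ¬ IsSquare (quadIter f (n + 2) 0) := by
  rintro ⟨y, hy⟩
  rw [quadIter_succ'] at hy
  set A := quadIter f (n + 1) 0 with hA
  have hdA : A.natDegree = f.natDegree * 2 ^ n := natDegree_critOrbit hf n
  have hAf : f.natDegree ≤ A.natDegree := by
    rw [hdA]; exact Nat.le_mul_of_pos_right _ (by positivity)
  have hf0 : f ≠ 0 := by rintro rfl; simp at hf
  have hfac : f = (y - A) * (y + A) := by linear_combination hy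
  -- one of the two factors has the degree of `A`, so the other one is constant
  have key : ∀ u v : L[X], f = u * v → v - u = 2 * A → v.natDegree < A.natDegree ∨
      ∃ g : L, u = C g := by
    intro u v huv hs
    by_contra! hcon
    obtain ⟨h1, h2⟩ := hcon
    have hu : u.natDegree ≠ 0 := fun h => by
      obtain ⟨g, hg⟩ := natDegree_eq_zero.1 h
      exact h2 g hg.symm
    have hu0 : u ≠ 0 := by rintro rfl; simp at huv; exact hf0 huv
    have hv0 : v ≠ 0 := by rintro rfl; simp at huv; exact hf0 huv
    have := natDegree_mul hu0 hv0
    rw [← huv] at this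
    omega
  have fin : ∀ g : L, f ≠ C g * (C g + 2 * A) := by
    intro g hfA
    have hg : g ≠ 0 := by rintro rfl; simp at hfA; exact hf0 hfA
    have hfd : f.natDegree = A.natDegree := by
      rw [hfA, natDegree_C_mul hg, natDegree_C_add, show (2 : L[X]) = C 2 from (map_ofNat C 2).symm,
        natDegree_C_mul two_ne_zero]
    have hn : n = 0 := by
      rw [hdA] at hfd
      have : 2 ^ n = 1 := Nat.eq_of_mul_eq_mul_left (Nat.pos_of_ne_zero hf) (by omega)
      simpa using this
    subst hn
    have hAf : A = f := by simp [hA, quadIter_succ', quadIter_zero]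
    rw [hAf] at hfA
    have he : f * C (1 - 2 * g) = C (g ^ 2) := by
      simp only [map_sub, map_one, map_mul, map_pow, map_ofNat]
      linear_combination hfA
    have he0 : 1 - 2 * g = 0 := by
      by_contra hne
      have := congrArg natDegree he
      rw [natDegree_mul_C hne, natDegree_C] at this
      exact hf this
    rw [he0, map_zero, mul_zero, eq_comm, C_eq_zero] at he
    exact hg (pow_eq_zero_iff two_ne_zero |>.1 he)
  rcases key (y - A) (y + A) hfac (by ring) with h | ⟨g, hg⟩
  · rcases key (-(y + A)) (-(y - A)) (by rw [hfac]; ring) (by ring) with h' | ⟨g, hg⟩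
    · have h2 : (2 * A).natDegree = A.natDegree := by
        rw [show (2 : L[X]) = C 2 from (map_ofNat C 2).symm, natDegree_C_mul two_ne_zero]
      have := natDegree_sub_le (y + A) (y - A)
      rw [show y + A - (y - A) = 2 * A by ring, h2] at this
      rw [natDegree_neg] at h'
      have := max_lt h h'
      omega
    · refine fin g ?_
      rw [← hg, hfac]; ring
  · refine fin g ?_
    rw [← hg, hfac]; ring

/-- The quartic `(x² + f)² + f` has a large squarefree part when `x` has large degree. -/
theorem natDegree_lt_of_quartic_eq [CharZero L] {f x D y : L[X]} (hf : f.natDegree ≠ 0)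
    (h : (x ^ 2 + f) ^ 2 + f = D * y ^ 2) :
    x.natDegree < 6 * f.natDegree + D.natDegree := by
  by_contra! hx
  obtain ⟨e, he⟩ := Nat.exists_eq_succ_of_ne_zero hf
  set A := x ^ 2 + f with hA
  have hdA : A.natDegree = 2 * x.natDegree := by
    rw [hA, natDegree_add_eq_left_of_natDegree_lt (by rw [natDegree_pow]; omega), natDegree_pow]
  obtain ⟨μ, hμ⟩ : ∃ μ, A.natDegree = μ + 1 := ⟨A.natDegree - 1, by omega⟩
  have hdc : (A ^ 2 + f).natDegree = 2 * A.natDegree := by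
    rw [natDegree_add_eq_left_of_natDegree_lt (by rw [natDegree_pow]; omega), natDegree_pow]
  have hc0 : A ^ 2 + f ≠ 0 := by intro h0; rw [h0] at hdc; simp at hdc; omega
  have hD0 : D ≠ 0 := by rintro rfl; simp at h; exact hc0 h
  have hy0 : y ≠ 0 := by rintro rfl; simp at h; exact hc0 h
  have hf0 : f ≠ 0 := by rintro rfl; simp at hf
  set Q := 2 * f * derivative A - derivative f * A with hQ
  have hder : 2 * A * derivative A + derivative f =
      y * (derivative D * y + 2 * D * derivative y) := by
    have := congrArg derivative h
    simp only [derivative_add, derivative_pow, derivative_mul] at this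
    simp only [Nat.cast_ofNat, map_ofNat] at this
    linear_combination this
  obtain ⟨s, hs⟩ : y ∣ f * Q := by
    refine ⟨D * y * Q - A * (f * (derivative D * y + 2 * D * derivative y)
      - derivative f * (D * y)), ?_⟩
    rw [hQ]
    linear_combination
      (2 * f * derivative A - derivative f * A + A * derivative f) * h - A * f * hder
  have hcs : (A ^ 2 + f) * s ^ 2 = D * (f * Q) ^ 2 := by rw [h, hs]; ring
  set P := f ^ 4 * derivative f ^ 2 * D - (f ^ 2 + f) * s ^ 2 with hP
  have hxP : x ∣ P := by
    have hQx : Q = f * derivative f + x * (4 * f * derivative x - x * derivative f) := by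
      rw [hQ, hA]
      simp only [derivative_add, derivative_pow]
      simp only [Nat.cast_ofNat, map_ofNat]
      ring
    have hcx : A ^ 2 + f = f ^ 2 + f + x * (x ^ 3 + 2 * f * x) := by rw [hA]; ring
    rw [hcx, hQx] at hcs
    set w := 4 * f * derivative x - x * derivative f
    refine ⟨(x ^ 3 + 2 * f * x) * s ^ 2
      - D * f ^ 2 * (2 * f * derivative f * w + x * w ^ 2), ?_⟩
    rw [hP]
    linear_combination -hcs
  have hdf' : (derivative f).natDegree ≤ e := by
    have := natDegree_derivative_le f; omega
  have hdA' : (derivative A).natDegree ≤ μ := by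
    have := natDegree_derivative_le A; omega
  have h2f : (2 * f).natDegree ≤ e + 1 := by
    rw [show (2 : L[X]) = C 2 from (map_ofNat C 2).symm, natDegree_C_mul two_ne_zero]; omega
  have hdQ : Q.natDegree ≤ e + 1 + μ := by
    refine (natDegree_sub_le_of_le (natDegree_mul_le_of_le h2f hdA') ?_).trans_eq (max_self _)
    refine (natDegree_mul_le_of_le hdf' hμ.le).trans (by omega)
  have hcQ : Q.coeff (e + 1 + μ) =
      (2 * (μ + 1) - (e + 1)) * f.leadingCoeff * A.leadingCoeff := by
    have h1 : (derivative f * A).coeff (e + (μ + 1)) = _ :=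
      coeff_mul_add_eq_of_natDegree_le hdf' hμ.le
    rw [hQ, coeff_sub, coeff_mul_add_eq_of_natDegree_le h2f hdA',
      show e + 1 + μ = e + (μ + 1) by ring, h1, coeff_derivative, coeff_derivative,
      show (2 : L[X]) = C 2 from (map_ofNat C 2).symm, coeff_C_mul, leadingCoeff, leadingCoeff, hμ, he]
    ring
  have hP0 : P ≠ 0 := by
    intro hP0
    have hmain : f * derivative f ^ 2 * (A ^ 2 + f) = (f + 1) * Q ^ 2 := by
      have hne : D * f ^ 3 ≠ 0 := mul_ne_zero hD0 (pow_ne_zero _ hf0)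
      apply mul_left_cancel₀ hne
      linear_combination (A ^ 2 + f) * hP0 + (f ^ 2 + f) * hcs
    have hdf1 : (f + 1).natDegree ≤ e + 1 := by
      refine natDegree_add_le_of_degree_le (by omega) (by simp)
    have hcf1 : (f + 1).coeff (e + 1) = f.leadingCoeff := by
      rw [coeff_add, leadingCoeff, he]; simp [coeff_one]
    have hdf2 : (derivative f ^ 2).natDegree ≤ 2 * e := natDegree_pow_le_of_le 2 hdf'
    have hcf2 : (derivative f ^ 2).coeff (2 * e) = ((e + 1) * f.leadingCoeff) ^ 2 := by
      rw [coeff_pow_of_natDegree_le hdf', coeff_derivative, leadingCoeff, he]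
      ring
    have hcQ2 : (Q ^ 2).coeff (2 * (e + 1 + μ)) = (Q.coeff (e + 1 + μ)) ^ 2 :=
      coeff_pow_of_natDegree_le hdQ
    have hcc : (A ^ 2 + f).coeff (2 * (μ + 1)) = A.leadingCoeff ^ 2 := by
      rw [coeff_add, coeff_eq_zero_of_natDegree_lt (p := f) (by omega), add_zero,
        coeff_pow_of_natDegree_le hμ.le, leadingCoeff, hμ]
    have hlhs : (f * derivative f ^ 2 * (A ^ 2 + f)).coeff (e + 1 + 2 * e + 2 * (μ + 1)) =
        f.leadingCoeff * ((e + 1) * f.leadingCoeff) ^ 2 * A.leadingCoeff ^ 2 := by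
      rw [coeff_mul_add_eq_of_natDegree_le (natDegree_mul_le_of_le he.le hdf2) (by omega),
        coeff_mul_add_eq_of_natDegree_le he.le hdf2, hcc, hcf2, leadingCoeff, he]
    have hrhs : ((f + 1) * Q ^ 2).coeff (e + 1 + 2 * (e + 1 + μ)) = f.leadingCoeff *
        ((2 * (μ + 1) - (e + 1)) * f.leadingCoeff * A.leadingCoeff) ^ 2 := by
      rw [coeff_mul_add_eq_of_natDegree_le hdf1
        (natDegree_pow_le_of_le 2 hdQ), hcf1, hcQ2, hcQ]
    rw [hmain, show e + 1 + 2 * e + 2 * (μ + 1) = e + 1 + 2 * (e + 1 + μ) by ring, hrhs] at hlhs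
    have hlf : f.leadingCoeff ≠ 0 := leadingCoeff_ne_zero.2 hf0
    have hlA : A.leadingCoeff ≠ 0 := leadingCoeff_ne_zero.2 (by intro h0; simp [h0] at hμ)
    have hnum : (((μ + 1) * (μ + 1) : ℕ) : L) = (((μ + 1) * (e + 1) : ℕ) : L) := by
      have h4 : (4 : L) * f.leadingCoeff ^ 3 * A.leadingCoeff ^ 2 ≠ 0 :=
        mul_ne_zero (mul_ne_zero (by norm_num) (pow_ne_zero _ hlf)) (pow_ne_zero _ hlA)
      apply mul_left_cancel₀ h4
      push_cast
      linear_combination hlhs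
    have := Nat.eq_of_mul_eq_mul_left (by omega) (Nat.cast_injective hnum)
    omega
  have hds : 2 * s.natDegree ≤ D.natDegree + 4 * e + 2 := by
    by_cases hs0 : s = 0
    · simp [hs0]
    · have h1 := congrArg natDegree hcs
      rw [natDegree_mul hc0 (pow_ne_zero _ hs0), natDegree_pow, hdc] at h1
      have h2 : (D * (f * Q) ^ 2).natDegree ≤ D.natDegree + 2 * (e + 1 + (e + 1 + μ)) :=
        natDegree_mul_le_of_le le_rfl
          (natDegree_pow_le_of_le 2 (natDegree_mul_le_of_le he.le hdQ))
      omega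
  have hdP : P.natDegree ≤ 6 * e + 4 + D.natDegree := by
    refine (natDegree_sub_le_of_le (n := 6 * e + 4 + D.natDegree)
      (m := 6 * e + 4 + D.natDegree) ?_ ?_).trans_eq (max_self _)
    · refine (natDegree_mul_le_of_le (natDegree_mul_le_of_le (natDegree_pow_le_of_le 4 he.le)
        (natDegree_pow_le_of_le 2 hdf')) le_rfl).trans (by omega)
    · have h3 : (f ^ 2 + f).natDegree ≤ 2 * (e + 1) :=
        natDegree_add_le_of_degree_le (natDegree_pow_le_of_le 2 he.le) (by omega)
      refine (natDegree_mul_le_of_le h3 (natDegree_pow_le_of_le 2 le_rfl)).trans (by omega)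
  have := natDegree_le_of_dvd hxP hP0
  omega

end DegreeBound

section Multiquadratic

variable {F E : Type*} [Field F] [Field E] [Algebra F E]

theorem exists_eq_add_mul_of_mem_adjoin_sq {b : F} {r z : E} (hr : r ^ 2 = algebraMap F E b)
    (hz : z ∈ IntermediateField.adjoin F {r}) :
    ∃ u v : F, z = algebraMap F E u + algebraMap F E v * r := by
  have hint : IsIntegral F r := ⟨X ^ 2 - C b, monic_X_pow_sub_C b two_ne_zero, by simp [hr]⟩
  rw [← IntermediateField.mem_toSubalgebra,
    IntermediateField.adjoin_simple_toSubalgebra_of_isAlgebraic hint.isAlgebraic] at hz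
  induction hz using Algebra.adjoin_induction with
  | mem x hx => exact ⟨0, 1, by simpa using hx⟩
  | algebraMap x => exact ⟨x, 0, by simp⟩
  | add x y _ _ hx hy =>
    obtain ⟨u, v, rfl⟩ := hx
    obtain ⟨u₁, v₁, rfl⟩ := hy
    exact ⟨u + u₁, v + v₁, by simp only [map_add]; ring⟩
  | mul x y _ _ hx hy =>
    obtain ⟨u, v, rfl⟩ := hx
    obtain ⟨u₁, v₁, rfl⟩ := hy
    refine ⟨u * u₁ + v * v₁ * b, u * v₁ + v * u₁, ?_⟩
    simp only [map_add, map_mul]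
    linear_combination (algebraMap F E v) * (algebraMap F E v₁) * hr

/-- A square in a quadratic extension of `F` that lies in `F` is a square in `F`,
up to the radicand. -/
theorem exists_sq_eq_or_of_mem_adjoin_sq [CharZero F] {b c : F} {r z : E}
    (hr : r ^ 2 = algebraMap F E b) (hz : z ∈ IntermediateField.adjoin F {r})
    (hc : z ^ 2 = algebraMap F E c) : IsSquare c ∨ IsSquare (c * b) := by
  obtain ⟨u, v, rfl⟩ := exists_eq_add_mul_of_mem_adjoin_sq hr hz
  have inj := (algebraMap F E).injective
  by_cases huv : u * v = 0
  · rcases mul_eq_zero.1 huv with rfl | rfl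
    · right
      refine ⟨v * b, inj ?_⟩
      simp only [map_mul, map_zero, zero_add] at hc ⊢
      linear_combination -(algebraMap F E b) * hc + (algebraMap F E v) ^ 2 * algebraMap F E b * hr
    · left
      refine ⟨u, inj ?_⟩
      simp only [map_mul, map_zero, zero_mul, add_zero] at hc ⊢
      linear_combination -hc
  · left
    have h2 : 2 * (u * v) ≠ 0 := mul_ne_zero two_ne_zero huv
    have hrF : algebraMap F E ((c - u ^ 2 - v ^ 2 * b) / (2 * (u * v))) = r := by
      have h3 : algebraMap F E (2 * (u * v)) ≠ 0 := by simpa using h2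
      rw [map_div₀, div_eq_iff h3]
      simp only [map_mul, map_sub, map_pow, map_ofNat]
      linear_combination -hc + (algebraMap F E v) ^ 2 * hr
    rw [← hrF] at hc
    refine ⟨u + v * ((c - u ^ 2 - v ^ 2 * b) / (2 * (u * v))), inj ?_⟩
    rw [← hc]
    simp only [map_mul, map_add]
    ring

variable {ι : Type*} [DecidableEq ι] {b : ι → F} {r : ι → E}

theorem adjoin_image_insert (r : ι → E) (j : ι) (T : Finset ι) :
    IntermediateField.adjoin F (r '' (insert j T : Finset ι)) =
      (IntermediateField.adjoin (IntermediateField.adjoin F (r '' T)) {r j}).restrictScalars F := by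
  rw [IntermediateField.adjoin_adjoin_left, Finset.coe_insert, Set.image_insert_eq,
    Set.union_comm, Set.insert_eq]

theorem exists_isSquare_mul_prod [CharZero F] (T : Finset ι)
    (hr : ∀ i ∈ T, r i ^ 2 = algebraMap F E (b i)) {c : F} {z : E} (hz : z ∈ IntermediateField.adjoin F (r '' T))
    (hc : z ^ 2 = algebraMap F E c) : ∃ S ⊆ T, IsSquare (c * ∏ i ∈ S, b i) := by
  induction T using Finset.induction_on generalizing c z with
  | empty =>
    simp only [Finset.coe_empty, Set.image_empty, IntermediateField.adjoin_empty] at hz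
    obtain ⟨u, rfl⟩ := IntermediateField.mem_bot.1 hz
    refine ⟨∅, subset_rfl, u, (algebraMap F E).injective ?_⟩
    simp [← hc, sq]
  | insert j T hj ih =>
    have ih := @ih fun i hi => hr i (Finset.mem_insert_of_mem hi)
    rw [adjoin_image_insert, IntermediateField.mem_restrictScalars] at hz
    set M := IntermediateField.adjoin F (r '' T)
    rcases exists_sq_eq_or_of_mem_adjoin_sq (b := algebraMap F M (b j)) (c := algebraMap F M c)
      (hr j (Finset.mem_insert_self _ _)) hz hc with ⟨w, hw⟩ | ⟨w, hw⟩
    · obtain ⟨S, hS, h⟩ := ih w.2 (c := c) (by rw [sq]; exact (congrArg (algebraMap M E) hw).symm)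
      exact ⟨S, hS.trans (Finset.subset_insert _ _), h⟩
    · obtain ⟨S, hS, h⟩ := ih w.2 (c := c * b j) (by
        rw [sq, map_mul]; exact (congrArg (algebraMap M E) hw).symm)
      refine ⟨insert j S, Finset.insert_subset_insert _ hS, ?_⟩
      rwa [Finset.prod_insert fun h => hj (hS h), ← mul_assoc]

/-- Adjoining square roots of elements that are multiplicatively independent modulo squares. -/
theorem finrank_adjoin_sqrt [CharZero F] (T : Finset ι)
    (hr : ∀ i ∈ T, r i ^ 2 = algebraMap F E (b i)) (hb : ∀ S ⊆ T, S.Nonempty → ¬ IsSquare (∏ i ∈ S, b i)) :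
    Module.finrank F (IntermediateField.adjoin F (r '' T)) = 2 ^ T.card := by
  induction T using Finset.induction_on with
  | empty =>
    simp
  | insert j T hj ih =>
    have hrT := fun i hi => hr i (Finset.mem_insert_of_mem (a := i) (b := j) hi)
    have ih := ih hrT fun S hS => hb S (hS.trans (Finset.subset_insert _ _))
    rw [adjoin_image_insert]
    set M := IntermediateField.adjoin F (r '' T)
    have hirr : Irreducible (X ^ 2 - C (algebraMap F M (b j)) : M[X]) := by
      rw [X_pow_sub_C_irreducible_iff_of_prime Nat.prime_two]
      intro w hw
      obtain ⟨S, hS, h⟩ := exists_isSquare_mul_prod T hrT w.2 (c := b j)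
        (congrArg (algebraMap M E) hw)
      refine hb (insert j S) (Finset.insert_subset_insert _ hS) (Finset.insert_nonempty _ _) ?_
      rwa [Finset.prod_insert fun h => hj (hS h)]
    have hmin : minpoly M (r j) = X ^ 2 - C (algebraMap F M (b j)) := by
      refine (minpoly.eq_of_irreducible_of_monic hirr ?_ (monic_X_pow_sub_C _ two_ne_zero)).symm
      simp [hr j (Finset.mem_insert_self _ _), ← IsScalarTower.algebraMap_apply]
    have hint : IsIntegral M (r j) := by
      by_contra h
      rw [minpoly.eq_zero h] at hmin
      exact hirr.ne_zero hmin.symm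
    have h2 : Module.finrank M (IntermediateField.adjoin M {r j}) = 2 := by
      rw [IntermediateField.adjoin.finrank hint, hmin, natDegree_X_pow_sub_C]
    have h3 := Module.finrank_mul_finrank F M (IntermediateField.adjoin M {r j})
    rw [Finset.card_insert_of_notMem hj, pow_succ, ← ih, ← h2]
    exact h3.symm

end Multiquadratic

section Stability

variable {K : Type*} [Field K]

theorem irreducible_comp_X_sq_add_C {P : K[X]} (hP : P.Monic) (hirr : Irreducible P) (c : K)
    (hc : ¬ IsSquare ((-1) ^ P.natDegree * P.eval c)) : Irreducible (P.comp (X ^ 2 + C c)) := by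
  have hshift : P.comp (X ^ 2 + C c) = (P.comp (X + C c)).comp (X ^ 2) := by
    simp [comp_assoc]
  have hirr' : Irreducible (P.comp (X + C c)) := by
    have := (MulEquiv.irreducible_iff (algEquivAevalXAddC c)).2 hirr
    simpa [algEquivAevalXAddC, ← comp_eq_aeval] using this
  rw [hshift]
  refine irreducible_comp (hP.comp_X_add_C c) (monic_X_pow 2) hirr' fun E _ _ x hx => ?_
  have hint : IsIntegral K x := by
    by_contra h
    rw [minpoly.eq_zero h] at hx
    exact hirr'.ne_zero hx.symm
  rw [Polynomial.map_pow, map_X]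
  refine X_pow_sub_C_irreducible_of_prime Nat.prime_two fun b hb => hc ⟨Algebra.norm K b, ?_⟩
  rw [← map_mul, ← sq, hb, ← IntermediateField.adjoin.powerBasis_gen hint,
    Algebra.PowerBasis.norm_gen_eq_coeff_zero_minpoly, ← PowerBasis.natDegree_minpoly,
    IntermediateField.adjoin.powerBasis_gen hint, IntermediateField.minpoly_gen, hx,
    natDegree_comp, natDegree_X_add_C, mul_one, coeff_zero_eq_eval_zero, eval_comp]
  simp

theorem irreducible_quadIter {c : K} (h₁ : ¬ IsSquare (-c))
    (h₂ : ∀ n, ¬ IsSquare (quadIter c (n + 2) 0)) (n : ℕ) :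
    Irreducible (quadIter (C c) n (X : K[X])) := by
  induction n with
  | zero => exact irreducible_X
  | succ n ih =>
    rw [quadIter_comp]
    refine irreducible_comp_X_sq_add_C (quadIter_monic c n) ih c ?_
    rw [eval_quadIter, natDegree_quadIter]
    cases n with
    | zero => simpa [quadIter_zero] using h₁
    | succ n =>
      have h := h₂ n
      rw [quadIter_succ] at h
      simpa [pow_succ'] using h

end Stability

section Maximality

variable {K : Type*} [Field K]

theorem iterate_aut_fixes_root {F : Type*} [Field F] [Algebra K F] (c : K) (m : ℕ)
    (σ : F ≃ₐ[K] F) {a : F} (ha : quadIter (algebraMap K F c) m a = 0) :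
    (σ ^ 2 ^ m) a = a := by
  induction m generalizing a with
  | zero =>
    rw [quadIter_zero] at ha
    simp [ha]
  | succ m ih =>
    have h := ih (a := a ^ 2 + algebraMap K F c) ha
    rw [map_add, AlgEquiv.commutes, map_pow, add_left_inj, sq_eq_sq_iff_eq_or_eq_neg] at h
    rw [pow_succ, pow_mul, sq, AlgEquiv.mul_apply]
    rcases h with h | h
    · rw [h, h]
    · rw [h, map_neg, h, neg_neg]

theorem isPGroup_aut_splittingField_quadIter (c : K) (m : ℕ) :
    IsPGroup 2 (SplittingField (quadIter (C c) m X) ≃ₐ[K] SplittingField (quadIter (C c) m X)) := by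
  intro σ
  refine ⟨m, AlgEquiv.coe_toAlgHom_injective ?_⟩
  refine AlgHom.ext_of_adjoin_eq_top (SplittingField.adjoin_rootSet _) fun a ha => ?_
  have hr := (mem_rootSet.1 ha).2
  rw [aeval_def, eval₂_eq_eval_map, map_quadIter_poly, eval_quadIter] at hr
  exact iterate_aut_fixes_root c m σ hr

open scoped Pointwise in
/-- The relations modulo squares among a Galois orbit under a `2`-group form a module for that
group, so a nontrivial relation yields the full product as a relation. -/
theorem isSquare_prod_of_isSquare_prod_subset {G F : Type*} [Group G] [Field F]
    [MulSemiringAction G F] [DecidableEq F] (hG : IsPGroup 2 G) {Rt : Finset F}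
    (hstab : ∀ (σ : G), ∀ a ∈ Rt, σ • a ∈ Rt)
    (htrans : ∀ a ∈ Rt, ∀ b ∈ Rt, ∃ σ : G, σ • a = b) {c : F} (hc : ∀ σ : G, σ • c = c)
    {S : Finset F} (hS : S ⊆ Rt) (hne : S.Nonempty) (hsq : IsSquare (∏ a ∈ S, (a - c))) :
    IsSquare (∏ a ∈ Rt, (a - c)) := by
  classical
  by_cases hzero : ∏ a ∈ Rt, (a - c) = 0
  · rw [hzero]
    exact IsSquare.zero
  set W : Finset (Finset F) := Rt.powerset.filter fun T => IsSquare (∏ a ∈ T, (a - c)) with hW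
  have hmem : ∀ T, T ∈ W ↔ T ⊆ Rt ∧ IsSquare (∏ a ∈ T, (a - c)) := by simp [hW]
  let V : SubMulAction G (Finset F) :=
    { carrier := W
      smul_mem' := by
        intro σ T hT
        rw [Finset.mem_coe, hmem] at hT ⊢
        refine ⟨?_, ?_⟩
        · intro b hb
          obtain ⟨a, ha, rfl⟩ := Finset.mem_smul_finset.1 hb
          exact hstab σ a (hT.1 ha)
        · obtain ⟨u, hu⟩ := hT.2
          refine ⟨σ • u, ?_⟩
          rw [← smul_mul', ← hu, Finset.smul_prod', Finset.smul_finset_def,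
            Finset.prod_image (fun a _ b _ h => MulAction.injective σ h)]
          refine Finset.prod_congr rfl fun a _ => ?_
          rw [smul_sub, hc] }
  have hsymm : ∀ T ∈ W, symmDiff T S ∈ W := by
    intro T hT
    rw [hmem] at hT ⊢
    refine ⟨(Finset.symmDiff_subset_union).trans (Finset.union_subset hT.1 hS), ?_⟩
    have hprod : (∏ a ∈ symmDiff T S, (a - c)) * (∏ a ∈ T ∩ S, (a - c)) ^ 2 =
        (∏ a ∈ T, (a - c)) * ∏ a ∈ S, (a - c) := by
      have h1 := Finset.prod_inter_mul_prod_sdiff T S (fun a => a - c)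
      have h2 := Finset.prod_inter_mul_prod_sdiff S T (fun a => a - c)
      rw [symmDiff_def, Finset.sup_eq_union, Finset.prod_union disjoint_sdiff_sdiff, ← h1, ← h2,
        Finset.inter_comm S T]
      ring
    have h0 : ∏ a ∈ T ∩ S, (a - c) ≠ 0 := Finset.prod_ne_zero_iff.2 fun a ha =>
      Finset.prod_ne_zero_iff.1 hzero a (hS (Finset.mem_inter.1 ha).2)
    obtain ⟨u, hu⟩ := hT.2.mul hsq
    refine ⟨u / ∏ a ∈ T ∩ S, (a - c), ?_⟩
    rw [div_mul_div_comm, eq_div_iff (mul_ne_zero h0 h0), ← sq, hprod, hu]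
  have heven : 2 ∣ Nat.card V := by
    have hcard : Nat.card V = W.card := by
      change Nat.card (W : Set (Finset F)) = _
      simp
    rw [hcard, ← ZMod.natCast_eq_zero_iff, ← nsmul_one, ← Finset.sum_const]
    refine Finset.sum_involution (fun T _ => symmDiff T S) (fun _ _ => by decide) ?_ hsymm ?_
    · intro T _ _ h
      rw [symmDiff_eq_left] at h
      exact hne.ne_empty h
    · intro T _
      exact symmDiff_symmDiff_cancel_right S T
  have hempty : (∅ : Finset F) ∈ V := (hmem ∅).2 ⟨by simp, by simp⟩
  have : Finite V := inferInstanceAs (Finite (W : Set (Finset F)))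
  obtain ⟨⟨T, hT⟩, hfix, hTne⟩ := hG.exists_fixed_point_of_prime_dvd_card_of_fixed_point V heven
    (a := ⟨∅, hempty⟩) (fun σ => Subtype.ext (by simp))
  obtain ⟨a, ha⟩ : T.Nonempty := by
    rw [Finset.nonempty_iff_ne_empty]
    rintro rfl
    exact hTne rfl
  obtain ⟨hTR, hTsq⟩ := (hmem T).1 hT
  have : T = Rt := by
    refine hTR.antisymm fun b hb => ?_
    obtain ⟨σ, rfl⟩ := htrans a (hTR ha) b hb
    have : σ • T = T := congrArg Subtype.val (hfix σ)
    rw [← this]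
    exact Finset.smul_mem_smul_finset ha
  rwa [← this]

variable [CharZero K]

/-- If the critical value is not a square in the splitting field of the previous iterate, then
the next layer of the tower is maximal. -/
theorem finrank_splittingField_quadIter {c : K} {m : ℕ} (hm : m ≠ 0)
    (hirr : Irreducible (quadIter (C c) m (X : K[X])))
    (hsq : ¬ IsSquare (algebraMap K (SplittingField (quadIter (C c) m (X : K[X])))
      (quadIter c (m + 1) 0))) :
    Module.finrank (SplittingField (quadIter (C c) m (X : K[X])))
      (SplittingField ((quadIter (C c) (m + 1) (X : K[X])).map
        (algebraMap K (SplittingField (quadIter (C c) m (X : K[X])))))) = 2 ^ 2 ^ m := by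
  classical
  set P := quadIter (C c) m (X : K[X]) with hP
  let F := SplittingField P
  set c' : F := algebraMap K F c with hc'
  set E := SplittingField ((quadIter (C c) (m + 1) (X : K[X])).map (algebraMap K F)) with hE
  have : CharZero F := charZero_of_injective_algebraMap (algebraMap K F).injective
  have hPm : P.Monic := quadIter_monic c m
  have hPd : P.natDegree = 2 ^ m := natDegree_quadIter c m
  have hsplit : (P.map (algebraMap K F)).Splits := SplittingField.splits P
  have hsep : P.Separable := hirr.separable
  let Rt : Finset F := (P.map (algebraMap K F)).roots.toFinset
  have hnodup : (P.map (algebraMap K F)).roots.Nodup := nodup_roots hsep.map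
  have hcard : Rt.card = 2 ^ m := by
    rw [Multiset.toFinset_card_of_nodup hnodup, ← hsplit.natDegree_eq_card_roots,
      natDegree_map, hPd]
  have hmem : ∀ a, a ∈ Rt ↔ quadIter c' m a = 0 := by
    intro a
    rw [Multiset.mem_toFinset, mem_roots (hPm.map _).ne_zero, IsRoot, map_quadIter_poly,
      eval_quadIter]
  have haeval : ∀ a ∈ Rt, aeval a P = 0 := by
    intro a ha
    rw [aeval_def, eval₂_eq_eval_map, map_quadIter_poly, eval_quadIter]
    exact (hmem a).1 ha
  have hmin : ∀ a ∈ Rt, minpoly K a = P := fun a ha =>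
    (minpoly.eq_of_irreducible_of_monic hirr (haeval a ha) hPm).symm
  have hprod : ∏ a ∈ Rt, (a - c') = algebraMap K F (quadIter c (m + 1) 0) := by
    have h1 : (P.map (algebraMap K F)).eval c' = ((P.map (algebraMap K F)).roots.map
        (c' - ·)).prod := hsplit.eval_eq_prod_roots_of_monic (hPm.map _) c'
    have h2 : ∏ a ∈ Rt, (c' - a) = (P.map (algebraMap K F)).eval c' := by
      rw [h1, Finset.prod, Multiset.toFinset_val, hnodup.dedup]
    have h3 : ∏ a ∈ Rt, (a - c') = ∏ a ∈ Rt, (c' - a) := by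
      rw [← Finset.prod_congr rfl (fun a _ => neg_sub c' a), Finset.prod_neg, hcard,
        (Nat.even_pow.2 ⟨even_two, hm⟩).neg_one_pow, one_mul]
    rw [h3, h2, eval_map_algebraMap, hc', aeval_algebraMap_apply, coe_aeval_eq_eval]
    congr 1
    rw [hP, eval_quadIter, quadIter_succ]
    simp
  have hind : ∀ S ⊆ Rt, S.Nonempty → ¬ IsSquare (∏ a ∈ S, (a - c')) := by
    intro S hS hne h
    refine hsq ?_
    rw [← hprod]
    refine isSquare_prod_of_isSquare_prod_subset (G := F ≃ₐ[K] F)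
      (isPGroup_aut_splittingField_quadIter c m) ?_ ?_ ?_ hS hne h
    · intro σ a ha
      rw [hmem] at ha ⊢
      have := congrArg σ ha
      rw [← AlgEquiv.coe_ringEquiv, ← RingEquiv.coe_toRingHom, map_quadIter] at this
      simpa [hc'] using this
    · intro a ha b hb
      refine minpoly.exists_algEquiv_of_root (K := K) (L := F)
        (Algebra.IsAlgebraic.isAlgebraic b) ?_
      rw [hmin b hb]
      exact haeval a ha
    · intro σ
      exact σ.commutes c
  have hsplitE : (((quadIter (C c) (m + 1) (X : K[X])).map (algebraMap K F)).map
      (algebraMap F E)).Splits := SplittingField.splits _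
  have hfac : ((quadIter (C c) (m + 1) (X : K[X])).map (algebraMap K F)) =
      (P.map (algebraMap K F)).comp (X ^ 2 + C c') := by
    rw [quadIter_comp, map_comp]
    simp [hc', hP]
  have hroot : ∀ a ∈ Rt, ∃ r : E, r ^ 2 = algebraMap F E (a - c') := by
    intro a ha
    have hdvd : X ^ 2 - C (algebraMap F E (a - c')) ∣
        ((quadIter (C c) (m + 1) (X : K[X])).map (algebraMap K F)).map (algebraMap F E) := by
      have h1 : X - C a ∣ P.map (algebraMap K F) :=
        dvd_iff_isRoot.2 (isRoot_of_mem_roots (Multiset.mem_toFinset.1 ha))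
      have h2 := map_dvd (mapRingHom (algebraMap F E)) (map_dvd (compRingHom (X ^ 2 + C c')) h1)
      simp only [coe_compRingHom_apply, coe_mapRingHom, ← hfac] at h2
      convert! h2 using 1
      simp
      ring
    have hne : ((quadIter (C c) (m + 1) (X : K[X])).map (algebraMap K F)).map (algebraMap F E) ≠ 0 :=
      (((quadIter_monic c (m + 1)).map _).map _).ne_zero
    obtain ⟨r, hr⟩ := (hsplitE.of_dvd hne hdvd).exists_eval_eq_zero
      (by rw [degree_X_pow_sub_C two_pos]; decide)
    refine ⟨r, ?_⟩
    rw [eval_sub, eval_pow, eval_X, eval_C, sub_eq_zero] at hr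
    exact hr
  choose! r hr using hroot
  have hfin := finrank_adjoin_sqrt (b := fun a => a - c') (r := r) Rt hr hind
  have htop : IntermediateField.adjoin F (r '' Rt) = ⊤ := by
    rw [eq_top_iff, ← IntermediateField.toSubalgebra_le_toSubalgebra,
      IntermediateField.top_toSubalgebra, ← SplittingField.adjoin_rootSet, Algebra.adjoin_le_iff]
    intro z hz
    have hz0 : aeval (R := F) (A := E) z ((P.map (algebraMap K F)).comp (X ^ 2 + C c')) = 0 :=
      (congrArg (aeval (R := F) (A := E) z) hfac).symm.trans (mem_rootSet.1 hz).2
    rw [aeval_comp] at hz0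
    obtain ⟨a, ha⟩ := hsplit.mem_range_of_isRoot (hPm.map _).ne_zero
      (i := algebraMap F E) (by rw [IsRoot, eval_map_algebraMap]; exact hz0)
    have haR : a ∈ Rt := by
      rw [Multiset.mem_toFinset, mem_roots (hPm.map _).ne_zero, IsRoot]
      rw [← ha, aeval_algebraMap_apply] at hz0
      simpa using hz0
    have hzr : z ^ 2 = r a ^ 2 := by
      rw [hr a haR, map_sub, ha]
      simp
    have hra : r a ∈ IntermediateField.adjoin F (r '' Rt) :=
      IntermediateField.subset_adjoin _ _ ⟨a, haR, rfl⟩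
    rcases sq_eq_sq_iff_eq_or_eq_neg.1 hzr with h | h
    · rw [h]; exact hra
    · rw [h]; exact neg_mem hra
  rw [htop, IntermediateField.finrank_top', hcard] at hfin
  exact hfin

end Maximality

section Expansion

variable {L : Type*} [Field L] {k : Type*} [Field k] [Algebra k L]

/-- Expansion of a polynomial at a point of an extension field. -/
noncomputable def expandAt (a : L) : k[X] →+* PowerSeries L :=
  (coeToPowerSeries.ringHom.comp (taylorAlgHom a).toRingHom).comp (mapRingHom (algebraMap k L))

theorem expandAt_apply (a : L) (g : k[X]) :
    expandAt a g = (taylor a (g.map (algebraMap k L)) : PowerSeries L) := rfl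

theorem expandAt_injective (a : L) : Function.Injective (expandAt (k := k) a) := by
  intro g g' h
  rw [expandAt_apply, expandAt_apply, coe_inj] at h
  exact map_injective _ (algebraMap k L).injective (taylor_injective a h)

theorem constantCoeff_expandAt (a : L) (g : k[X]) :
    PowerSeries.constantCoeff (expandAt a g) = (g.map (algebraMap k L)).eval a := by
  rw [expandAt_apply, ← PowerSeries.coeff_zero_eq_constantCoeff_apply, coeff_coe, taylor_coeff_zero]

theorem order_expandAt (a : L) {g : k[X]} (hg : g ≠ 0) :
    (expandAt a g).order = (rootMultiplicity a (g.map (algebraMap k L)) : ℕ) := by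
  have hg' : g.map (algebraMap k L) ≠ 0 :=
    (Polynomial.map_ne_zero_iff (algebraMap k L).injective).2 hg
  obtain ⟨q, hq, hndvd⟩ := exists_eq_pow_rootMultiplicity_mul_and_not_dvd _ hg' a
  rw [expandAt_apply]
  set e := rootMultiplicity a (g.map (algebraMap k L))
  have hq0 : PowerSeries.constantCoeff (taylor a q : PowerSeries L) ≠ 0 := by
    rw [← PowerSeries.coeff_zero_eq_constantCoeff_apply, coeff_coe, taylor_coeff_zero]
    rwa [dvd_iff_isRoot] at hndvd
  have hunit : IsUnit (taylor a q : PowerSeries L) := by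
    rw [PowerSeries.isUnit_iff_constantCoeff]
    exact hq0.isUnit
  rw [hq, taylor_mul, taylor_pow, map_sub, taylor_X, taylor_C, add_sub_cancel_right, coe_mul,
    coe_pow, coe_X, PowerSeries.order_mul, PowerSeries.order_X_pow,
    PowerSeries.order_zero_of_unit hunit, add_zero]

end Expansion

section Ramification

theorem splits_comp_X_sq_add_C {Λ : Type*} [Field Λ] {P : Λ[X]} (hP : P.Monic) (hs : P.Splits)
    (c : Λ) (h : ∀ β ∈ P.roots, IsSquare (β - c)) : (P.comp (X ^ 2 + C c)).Splits := by
  rw [hs.eq_prod_roots_of_monic hP, multiset_prod_comp]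
  refine Splits.multisetProd fun q hq => ?_
  simp only [Multiset.map_map, Multiset.mem_map, Function.comp_apply] at hq
  obtain ⟨β, hβ, rfl⟩ := hq
  obtain ⟨r, hr⟩ := h β hβ
  have : (X - C β).comp (X ^ 2 + C c) = (X - C r) * (X + C r) := by
    rw [sub_comp, X_comp, C_comp]
    have : C β - C c = C r * C r := by rw [← C_sub, hr, C_mul]
    linear_combination -this
  rw [this]
  exact (Splits.X_sub_C r).mul (Splits.X_add_C r)

variable {L : Type*} [Field L] [IsAlgClosed L] [CharZero L]

theorem isSquare_powerSeries_of_constantCoeff_ne_zero {p : PowerSeries L}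
    (hp : PowerSeries.constantCoeff p ≠ 0) : IsSquare p := by
  obtain ⟨s, hs⟩ := IsAlgClosed.exists_pow_nat_eq (PowerSeries.constantCoeff p) two_pos
  have hs0 : s ≠ 0 := by
    rintro rfl
    exact hp (by simpa using hs.symm)
  obtain ⟨q, hq, -⟩ := HenselianRing.is_henselian
    (I := (Ideal.span {PowerSeries.X} : Ideal (PowerSeries L)))
    (X ^ 2 - C p) (monic_X_pow_sub_C p two_ne_zero) (PowerSeries.C s)
    (by
      rw [Ideal.mem_span_singleton, PowerSeries.X_dvd_iff]
      simp [hs])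
    (by
      refine IsUnit.map _ ?_
      rw [PowerSeries.isUnit_iff_constantCoeff]
      simpa using hs0)
  refine ⟨q, ?_⟩
  rw [IsRoot, eval_sub, eval_pow, eval_X, eval_C, sub_eq_zero] at hq
  rw [← hq, sq]

/-- When the critical orbit avoids zero modulo the maximal ideal, the iterates split over the
field of fractions of the ring of power series. -/
theorem splits_quadIter_fractionRing {Λ : Type*} [Field Λ] [Algebra (PowerSeries L) Λ]
    [IsFractionRing (PowerSeries L) Λ] (c : PowerSeries L) (m : ℕ)
    (h : ∀ i, 0 < i → i ≤ m → PowerSeries.constantCoeff (quadIter c i 0) ≠ 0) :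
    (quadIter (C (algebraMap (PowerSeries L) Λ c)) m (X : Λ[X])).Splits := by
  induction m with
  | zero => exact Splits.X
  | succ m ih =>
    have ih := ih fun i hi him => h i hi (by omega)
    rw [quadIter_comp]
    refine splits_comp_X_sq_add_C (quadIter_monic _ m) ih _ fun β hβ => ?_
    have hβ0 : quadIter (algebraMap (PowerSeries L) Λ c) m β = 0 := by
      rw [← eval_quadIter]
      exact isRoot_of_mem_roots hβ
    obtain ⟨w, rfl⟩ := (IsIntegrallyClosed.isIntegral_iff (R := PowerSeries L) (x := β)).1
      ⟨quadIter (C c) m X, quadIter_monic c m, by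
        rw [eval₂_eq_eval_map, map_quadIter_poly, eval_quadIter, hβ0]⟩
    rw [← map_quadIter, map_eq_zero_iff _ (IsFractionRing.injective (PowerSeries L) Λ)] at hβ0
    rw [← map_sub]
    refine IsSquare.map _ (isSquare_powerSeries_of_constantCoeff_ne_zero ?_)
    intro hw
    refine h (m + 1) (by omega) le_rfl ?_
    rw [map_sub, sub_eq_zero] at hw
    have := congrArg PowerSeries.constantCoeff hβ0
    rw [map_quadIter, hw, map_zero] at this
    rw [map_quadIter, quadIter_succ]
    simpa using this

variable {k : Type*} [Field k] [Algebra k L]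

/-- If a polynomial becomes a square in the splitting field of an iterate, then its zeros away
from the critical orbit have even multiplicity. -/
theorem even_rootMultiplicity_of_isSquare {f g : k[X]} (hg : g ≠ 0) {m : ℕ}
    (hsq : IsSquare (algebraMap (RatFunc k)
      (SplittingField (quadIter (C (algebraMap k[X] (RatFunc k) f)) m (X : (RatFunc k)[X])))
      (algebraMap k[X] (RatFunc k) g))) (a : L)
    (ha : ∀ i, 0 < i → i ≤ m → (quadIter (f.map (algebraMap k L)) i 0).eval a ≠ 0) :
    Even (rootMultiplicity a (g.map (algebraMap k L))) := by
  let Λ := FractionRing (PowerSeries L)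
  let j : k[X] →+* Λ := (algebraMap (PowerSeries L) Λ).comp (expandAt a)
  have hj : Function.Injective j :=
    (IsFractionRing.injective (PowerSeries L) Λ).comp (expandAt_injective a)
  let _ : Algebra (RatFunc k) Λ := (IsFractionRing.lift (K := RatFunc k) hj).toAlgebra
  have hmap : ∀ p : k[X], algebraMap (RatFunc k) Λ (algebraMap k[X] (RatFunc k) p) =
      algebraMap (PowerSeries L) Λ (expandAt a p) := fun p => IsFractionRing.lift_algebraMap hj p
  have hsplit : ((quadIter (C (algebraMap k[X] (RatFunc k) f)) m (X : (RatFunc k)[X])).map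
      (algebraMap (RatFunc k) Λ)).Splits := by
    rw [map_quadIter_poly, hmap]
    refine splits_quadIter_fractionRing _ m fun i hi him => ?_
    have h0 := map_quadIter (expandAt (k := k) a) f 0 i
    rw [map_zero] at h0
    rw [← h0, constantCoeff_expandAt]
    have h1 := map_quadIter (mapRingHom (algebraMap k L)) f 0 i
    rw [map_zero, coe_mapRingHom] at h1
    rw [h1]
    exact ha i hi him
  have h := hsq.map (SplittingField.lift _ hsplit)
  rw [AlgHom.commutes, hmap] at h
  obtain ⟨u, hu⟩ := h
  obtain ⟨v, rfl⟩ := IsIntegrallyClosed.exists_algebraMap_eq_of_isIntegral_pow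
    (R := PowerSeries L) (x := u) two_pos (by rw [sq, ← hu]; exact isIntegral_algebraMap)
  rw [← map_mul, (IsFractionRing.injective (PowerSeries L) Λ).eq_iff] at hu
  have ho := order_expandAt a hg
  rw [hu, PowerSeries.order_mul] at ho
  have hv : v ≠ 0 := by
    rintro rfl
    simp at ho
  rw [← PowerSeries.coe_toNat_order hv] at ho
  exact ⟨v.order.toNat, by exact_mod_cast ho.symm⟩

end Ramification

section Conclusion

theorem exists_eq_prod_odd_mul_sq {L : Type*} [Field L] [IsAlgClosed L] [DecidableEq L]
    (p : L[X]) :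
    ∃ y, p = (∏ a ∈ p.roots.toFinset with Odd (p.rootMultiplicity a), (X - C a)) * y ^ 2 := by
  obtain ⟨u, hu⟩ := IsAlgClosed.exists_pow_nat_eq p.leadingCoeff two_pos
  refine ⟨C u * ∏ a ∈ p.roots.toFinset, (X - C a) ^ (p.rootMultiplicity a / 2), ?_⟩
  have h := (IsAlgClosed.splits p).eq_prod_roots
  rw [Finset.prod_multiset_map_count] at h
  rw [Finset.prod_filter, mul_pow, mul_left_comm, ← C_pow, hu, ← Finset.prod_pow,
    ← Finset.prod_mul_distrib]
  refine h.trans (congrArg _ (Finset.prod_congr rfl fun a _ => ?_))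
  rw [count_roots, ← pow_mul]
  split_ifs with hodd
  · rw [← pow_succ', Nat.div_two_mul_two_add_one_of_odd hodd]
  · rw [one_mul, Nat.div_two_mul_two_of_even (Nat.not_odd_iff_even.1 hodd)]

theorem card_le_of_roots_critOrbit {L : Type*} [Field L] [DecidableEq L] {f : L[X]}
    (hf : f.natDegree ≠ 0) {n : ℕ} {S : Finset L}
    (hS : ∀ a ∈ S, ∃ j, 0 < j ∧ j ≤ n ∧ (quadIter f j 0).eval a = 0) :
    S.card ≤ f.natDegree * 2 ^ n := by
  have hsub : S ⊆ (Finset.range n).biUnion fun j => (quadIter f (j + 1) 0).roots.toFinset := by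
    intro a ha
    obtain ⟨j, hj0, hjn, hj⟩ := hS a ha
    obtain ⟨i, rfl⟩ := Nat.exists_eq_succ_of_ne_zero hj0.ne'
    refine Finset.mem_biUnion.2 ⟨i, Finset.mem_range.2 hjn, ?_⟩
    have hne : quadIter f (i + 1) 0 ≠ 0 := by
      intro h0
      have := natDegree_critOrbit hf i
      rw [h0, natDegree_zero] at this
      exact mul_ne_zero hf (by positivity) this.symm
    rw [Multiset.mem_toFinset, mem_roots hne]
    exact hj
  calc S.card ≤ _ := Finset.card_le_card hsub
    _ ≤ ∑ j ∈ Finset.range n, (quadIter f (j + 1) 0).roots.toFinset.card := Finset.card_biUnion_le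
    _ ≤ ∑ j ∈ Finset.range n, f.natDegree * 2 ^ j := by
      refine Finset.sum_le_sum fun j _ => ?_
      rw [← natDegree_critOrbit hf j]
      exact (Multiset.toFinset_card_le _).trans (card_roots' _)
    _ ≤ f.natDegree * 2 ^ n := by
      rw [← Finset.mul_sum]
      exact Nat.mul_le_mul_left _ (Nat.geomSum_lt le_rfl (by simp)).le

/-- The critical values of large index are not squares in the preceding splitting field. -/
theorem not_isSquare_critOrbit_splittingField {k : Type*} [Field k] [CharZero k] {f : k[X]}
    (hf : f.natDegree ≠ 0) {m : ℕ} (hm : 16 ≤ m) :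
    ¬ IsSquare (algebraMap (RatFunc k)
      (SplittingField (quadIter (C (algebraMap k[X] (RatFunc k) f)) m (X : (RatFunc k)[X])))
      (quadIter (algebraMap k[X] (RatFunc k) f) (m + 1) 0)) := by
  classical
  intro hsq
  let L := AlgebraicClosure k
  set g : L[X] := f.map (algebraMap k L) with hg
  have hgd : g.natDegree = f.natDegree := natDegree_map _
  have hg0 : g.natDegree ≠ 0 := by rwa [hgd]
  have : CharZero L := charZero_of_injective_algebraMap (algebraMap k L).injective
  have hmapL : (quadIter f (m + 1) 0).map (algebraMap k L) = quadIter g (m + 1) 0 := by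
    have := map_quadIter (mapRingHom (algebraMap k L)) f 0 (m + 1)
    rwa [map_zero, coe_mapRingHom] at this
  have hmapK := map_quadIter (algebraMap k[X] (RatFunc k)) f 0 (m + 1)
  rw [map_zero] at hmapK
  rw [← hmapK] at hsq
  have hc0 : quadIter f (m + 1) 0 ≠ 0 := by
    intro h0
    have := natDegree_critOrbit hf m
    rw [h0, natDegree_zero] at this
    exact mul_ne_zero hf (by positivity) this.symm
  obtain ⟨y, hy⟩ := exists_eq_prod_odd_mul_sq (quadIter g (m + 1) 0)
  set S := {a ∈ (quadIter g (m + 1) 0).roots.toFinset |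
    Odd ((quadIter g (m + 1) 0).rootMultiplicity a)} with hS
  have hcard : S.card ≤ g.natDegree * 2 ^ ((m + 1) / 2) := by
    refine card_le_of_roots_critOrbit hg0 fun a ha => ?_
    rw [hS, Finset.mem_filter, Multiset.mem_toFinset] at ha
    have hev : ∀ i, (quadIter g i 0).eval a = quadIter (g.eval a) i 0 := by
      intro i
      simpa using map_quadIter (evalRingHom a) g 0 i
    have hex : ∃ i, 0 < i ∧ i ≤ m ∧ (quadIter g i 0).eval a = 0 := by
      by_contra! hcon
      refine Nat.not_even_iff_odd.2 ha.2 ?_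
      rw [← hmapL]
      exact even_rootMultiplicity_of_isSquare hc0 hsq a hcon
    obtain ⟨i, hi0, him, hi⟩ := hex
    simp only [hev] at hi ⊢
    refine exists_quadIter_eq_zero_le_half hi0 (Nat.lt_succ_of_le him) hi ?_
    rw [← hev]
    exact isRoot_of_mem_roots ha.1
  obtain ⟨l, rfl⟩ : ∃ l, m = l + 2 := ⟨m - 2, by omega⟩
  rw [quadIter_succ', quadIter_succ'] at hy
  have hlt := natDegree_lt_of_quartic_eq hg0 hy
  rw [natDegree_critOrbit hg0, natDegree_prod_of_monic _ _ (fun a _ => monic_X_sub_C a)] at hlt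
  simp only [natDegree_X_sub_C, Finset.sum_const, smul_eq_mul, mul_one] at hlt
  have h1 : g.natDegree * 2 ^ l < g.natDegree * (6 + 2 ^ ((l + 2 + 1) / 2)) := by
    calc _ < _ := hlt
      _ ≤ _ := by rw [mul_add, mul_comm 6]; exact Nat.add_le_add_left hcard _
  have h2 := lt_of_mul_lt_mul_left h1 (Nat.zero_le _)
  have h3 : 2 ^ ((l + 2 + 1) / 2 + 1) ≤ 2 ^ l := Nat.pow_le_pow_right two_pos (by omega)
  have h4 : 2 ^ 3 ≤ 2 ^ ((l + 2 + 1) / 2) := Nat.pow_le_pow_right two_pos (by omega)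
  rw [pow_succ] at h3
  omega

theorem isSquare_of_isSquare_algebraMap_ratFunc {k : Type*} [Field k] {g : k[X]}
    (h : IsSquare (algebraMap k[X] (RatFunc k) g)) : IsSquare g := by
  obtain ⟨u, hu⟩ := h
  obtain ⟨v, rfl⟩ := IsIntegrallyClosed.exists_algebraMap_eq_of_isIntegral_pow
    (R := k[X]) (x := u) two_pos (by rw [sq, ← hu]; exact isIntegral_algebraMap)
  rw [← map_mul, (IsFractionRing.injective k[X] (RatFunc k)).eq_iff] at hu
  exact ⟨v, hu⟩

end Conclusion

/-- Corollary 2 (uniform bound for `x² + f`): if `f ∈ k[t]` is non-constant and `-f` is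
not a square, then `φ_f = x² + f` is stable and `K_n/K_{n-1}` is maximal for all `n ≥ 17`. -/
theorem uniform_bound_x_sq_add_f (k : Type*) [Field k] [CharZero k] (f : Polynomial k)
    (hf : f.natDegree ≠ 0)
    (hsq : ¬ IsSquare (-f))
    (φ : Polynomial (RatFunc k))
    (hφ : φ = X ^ 2 + C (algebraMap (Polynomial k) (RatFunc k) f)) :
    (∀ n : ℕ, 1 ≤ n →
      Irreducible ((fun p => p.comp φ)^[n] (X : Polynomial (RatFunc k)))) ∧
    (∀ n : ℕ, 17 ≤ n →
      Module.finrank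
        (Polynomial.SplittingField ((fun p => p.comp φ)^[n - 1] (X : Polynomial (RatFunc k))))
        (Polynomial.SplittingField
          (((fun p => p.comp φ)^[n] (X : Polynomial (RatFunc k))).map
            (algebraMap (RatFunc k)
              (Polynomial.SplittingField
                ((fun p => p.comp φ)^[n - 1] (X : Polynomial (RatFunc k)))))))
      = 2 ^ 2 ^ (n - 1)) := by
  subst hφ
  have hirr : ∀ n, Irreducible
      (quadIter (C (algebraMap k[X] (RatFunc k) f)) n (X : (RatFunc k)[X])) := by
    refine irreducible_quadIter ?_ fun n h => ?_
    · rw [← map_neg]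
      exact fun h => hsq (isSquare_of_isSquare_algebraMap_ratFunc h)
    · have hmap := map_quadIter (algebraMap k[X] (RatFunc k)) f 0 (n + 2)
      rw [map_zero] at hmap
      rw [← hmap] at h
      exact not_isSquare_critOrbit hf n (isSquare_of_isSquare_algebraMap_ratFunc h)
  refine ⟨fun n _ => ?_, fun n hn => ?_⟩
  · rw [iterate_comp_eq_quadIter]
    exact hirr n
  · obtain ⟨m, rfl⟩ : ∃ m, n = m + 1 := ⟨n - 1, by omega⟩
    have hdeg := finrank_splittingField_quadIter (by omega) (hirr m)
      (not_isSquare_critOrbit_splittingField hf (by omega))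
    rw [← iterate_comp_eq_quadIter, ← iterate_comp_eq_quadIter] at hdeg
    exact hdeg
end
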